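/- Let (Ω,μ,T) be a weak mixing probability measure-preserving system, let β be irrational, let g: [0,1) → ℝ be Riemann integrable, and let F: Ω → ℝ be bounded and measurable. Then there is a set Ω' ⊆ Ω of full μ-measure such that for all ω ∈ Ω' and all t ∈ [0,1): (1/N) ∑_{k=1}^N g({t+kβ}) · F(T^k ω) → (∫_0^1 g dλ) · E_μ[F] as N → ∞. -/

import Mathlib

open MeasureTheory Filter Topology

/-- A probability measure-preserving system `(Ω, μ, T)` is weak mixing if the product
system `(Ω × Ω, μ × μ, T × T)` is ergodic. -/
def WeakMixing {Ω : Type*} [MeasurableSpace Ω] (T : Ω → Ω) (μ : Measure Ω) : Prop :=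
  Ergodic (Prod.map T T) (μ.prod μ)

/-- The Cesàro average of the first `N` terms of a sequence. -/
noncomputable def cesaro {E : Type*} [AddCommMonoid E] [Module ℝ E] (u : ℕ → E) (N : ℕ) : E :=
  (N : ℝ)⁻¹ • ∑ k ∈ Finset.range N, u k

section Birkhoff

variable {Ω : Type*}

/-- The running maximum `max_{0 ≤ k ≤ n} ∑_{j < k} f (T^j ω)` of the Birkhoff sums,
defined recursively. -/
noncomputable def birkhoffMax (T : Ω → Ω) (f : Ω → ℝ) : ℕ → Ω → ℝ
  | 0 => fun _ => 0
  | n + 1 => fun ω => max 0 (f ω + birkhoffMax T f n (T ω))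

lemma birkhoffMax_nonneg (T : Ω → Ω) (f : Ω → ℝ) (n : ℕ) (ω : Ω) : 0 ≤ birkhoffMax T f n ω := by
  cases n <;> simp [birkhoffMax]

lemma birkhoffMax_mono (T : Ω → Ω) (f : Ω → ℝ) (ω : Ω) :
    Monotone fun n => birkhoffMax T f n ω := by
  refine monotone_nat_of_le_succ fun n => ?_
  induction n generalizing ω with
  | zero => exact birkhoffMax_nonneg T f 1 ω
  | succ n ih =>
    have := ih (T ω)
    simp only [birkhoffMax] at this ⊢
    gcongr

lemma birkhoffSum_le_birkhoffMax (T : Ω → Ω) (f : Ω → ℝ) (n : ℕ) (ω : Ω) :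
    birkhoffSum T f n ω ≤ birkhoffMax T f n ω := by
  induction n generalizing ω with
  | zero => simp [birkhoffMax]
  | succ n ih =>
    rw [birkhoffSum_succ']
    exact le_max_of_le_right (by gcongr; exact ih _)

lemma bddAbove_birkhoffMax_comp_iff (T : Ω → Ω) (f : Ω → ℝ) (ω : Ω) :
    BddAbove (Set.range fun n => birkhoffMax T f n (T ω)) ↔
      BddAbove (Set.range fun n => birkhoffMax T f n ω) := by
  constructor
  · rintro ⟨C, hC⟩
    refine ⟨max 0 (f ω + C), ?_⟩
    rintro _ ⟨n, rfl⟩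
    cases n with
    | zero => simp [birkhoffMax]
    | succ n =>
      have := hC ⟨n, rfl⟩
      simp only [birkhoffMax] at this ⊢
      gcongr
  · rintro ⟨C, hC⟩
    refine ⟨C - f ω, ?_⟩
    rintro _ ⟨n, rfl⟩
    have h1 : birkhoffMax T f (n + 1) ω ≤ C := hC ⟨n + 1, rfl⟩
    have h2 : f ω + birkhoffMax T f n (T ω) ≤ birkhoffMax T f (n + 1) ω := le_max_right _ _
    simp only
    linarith

variable [MeasurableSpace Ω] {T : Ω → Ω} {μ : Measure Ω} {f : Ω → ℝ}

lemma measurable_birkhoffMax (hT : Measurable T) (hf : Measurable f) (n : ℕ) :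
    Measurable (birkhoffMax T f n) := by
  induction n with
  | zero => exact measurable_const
  | succ n ih => exact measurable_const.max (hf.add (ih.comp hT))

lemma integrable_birkhoffMax (hT : MeasurePreserving T μ μ) (hf : Integrable f μ) (n : ℕ) :
    Integrable (birkhoffMax T f n) μ := by
  induction n with
  | zero => exact integrable_zero _ _ _
  | succ n ih => exact (integrable_zero _ _ _).sup (hf.add (hT.integrable_comp_of_integrable ih))

/-- If `∫ f < 0` and `T` is ergodic, then almost every orbit has Birkhoff sums bounded above. -/
lemma Ergodic.ae_bddAbove_birkhoffMax [IsProbabilityMeasure μ] (hT : Ergodic T μ)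
    (hf : Measurable f) (hfi : Integrable f μ) (hneg : ∫ ω, f ω ∂μ < 0) :
    ∀ᵐ ω ∂μ, BddAbove (Set.range fun n => birkhoffMax T f n ω) := by
  have hmeas : MeasurableSet {ω | BddAbove (Set.range fun n => birkhoffMax T f n ω)} :=
    measurableSet_bddAbove_range (measurable_birkhoffMax hT.measurable hf)
  refine (hT.ae_mem_or_ae_notMem hmeas ?_).resolve_right fun hunb => ?_
  · ext ω
    exact bddAbove_birkhoffMax_comp_iff T f ω
  have hlim : Tendsto (fun n => ∫ ω, max (-birkhoffMax T f n (T ω)) (f ω) ∂μ) atTop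
      (𝓝 (∫ ω, f ω ∂μ)) := by
    refine tendsto_integral_of_dominated_convergence (fun ω => |f ω|) (fun n => ?_) hfi.abs
      (fun n => ?_) ?_
    · exact (((measurable_birkhoffMax hT.measurable hf n).comp hT.measurable).neg.max
        hf).aestronglyMeasurable
    · refine ae_of_all _ fun ω => ?_
      have := birkhoffMax_nonneg T f n (T ω)
      rw [Real.norm_eq_abs, abs_le]
      exact ⟨(neg_abs_le _).trans (le_max_right _ _),
        max_le (by linarith [abs_nonneg (f ω)]) (le_abs_self _)⟩
    · filter_upwards [hunb] with ω hω
      replace hω : ¬ BddAbove (Set.range fun n => birkhoffMax T f n (T ω)) := by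
        rwa [bddAbove_birkhoffMax_comp_iff]
      have htop := tendsto_atTop_atTop_of_monotone' (birkhoffMax_mono T f (T ω)) hω
      refine tendsto_const_nhds.congr' ?_
      filter_upwards [htop.eventually_ge_atTop (-f ω)] with n hn
      rw [max_eq_right]
      linarith
  refine hneg.not_ge (ge_of_tendsto' hlim fun n => ?_)
  have hM := integrable_birkhoffMax hT.toMeasurePreserving hfi
  have hMT : Integrable (fun ω => birkhoffMax T f n (T ω)) μ :=
    hT.toMeasurePreserving.integrable_comp_of_integrable (hM n)
  have hcomp : ∫ ω, birkhoffMax T f n (T ω) ∂μ = ∫ ω, birkhoffMax T f n ω ∂μ := by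
    have := integral_map (μ := μ) hT.measurable.aemeasurable
      (measurable_birkhoffMax hT.measurable hf n).aestronglyMeasurable
    rw [← this, hT.map_eq]
  have heq : ∀ ω, max (-birkhoffMax T f n (T ω)) (f ω) =
      birkhoffMax T f (n + 1) ω - birkhoffMax T f n (T ω) := fun ω => by
    simp only [birkhoffMax]
    rw [← max_sub_sub_right]
    simp
  simp_rw [heq]
  rw [integral_sub (hM _) hMT, hcomp,
    sub_nonneg]
  exact integral_mono (hM _) (hM _) fun ω => birkhoffMax_mono T f ω n.le_succ

lemma Ergodic.ae_eventually_cesaro_le [IsProbabilityMeasure μ] (hT : Ergodic T μ)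
    (hf : Measurable f) (hfi : Integrable f μ) {a : ℝ} (ha : ∫ ω, f ω ∂μ < a) :
    ∀ᵐ ω ∂μ, ∀ᶠ N in atTop, cesaro (fun k => f (T^[k] ω)) N ≤ a := by
  obtain ⟨b, hb, hba⟩ := exists_between ha
  have hneg : ∫ ω, (f ω - b) ∂μ < 0 := by
    rw [integral_sub hfi (integrable_const _)]
    simpa using hb
  filter_upwards [hT.ae_bddAbove_birkhoffMax (hf.sub_const b) (hfi.sub (integrable_const b)) hneg]
    with ω ⟨C, hC⟩
  have hlim : Tendsto (fun N : ℕ => C * (N : ℝ)⁻¹ + b) atTop (𝓝 (C * 0 + b)) :=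
    (tendsto_natCast_atTop_atTop.inv_tendsto_atTop.const_mul C).add_const b
  filter_upwards [hlim.eventually_lt_const (by simpa using hba), eventually_gt_atTop 0] with N hN hN0
  have h1 := (birkhoffSum_le_birkhoffMax T (fun ω => f ω - b) N ω).trans (hC ⟨N, rfl⟩)
  have hN' : (0 : ℝ) < N := by exact_mod_cast hN0
  rw [birkhoffSum, Finset.sum_sub_distrib] at h1
  simp only [Finset.sum_const, Finset.card_range, nsmul_eq_mul] at h1
  refine le_trans ?_ hN.le
  rw [cesaro, smul_eq_mul, inv_mul_le_iff₀ hN']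
  field_simp
  linarith

/-- Birkhoff's pointwise ergodic theorem, for ergodic transformations. -/
theorem Ergodic.ae_tendsto_cesaro [IsProbabilityMeasure μ] (hT : Ergodic T μ)
    (hf : Measurable f) (hfi : Integrable f μ) :
    ∀ᵐ ω ∂μ, Tendsto (cesaro fun k => f (T^[k] ω)) atTop (𝓝 (∫ ω, f ω ∂μ)) := by
  have hpos : ∀ n : ℕ, (0 : ℝ) < 1 / (n + 1) := fun n => Nat.one_div_pos_of_nat
  have hup := ae_all_iff.2 fun n : ℕ =>
    hT.ae_eventually_cesaro_le hf hfi (lt_add_of_pos_right _ (hpos n))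
  have hlow := ae_all_iff.2 fun n : ℕ =>
    hT.ae_eventually_cesaro_le hf.neg hfi.neg (lt_add_of_pos_right _ (hpos n))
  filter_upwards [hup, hlow] with ω h1 h2
  rw [Metric.tendsto_nhds]
  intro ε hε
  obtain ⟨n, hn⟩ := exists_nat_one_div_lt hε
  filter_upwards [h1 n, h2 n] with N h3 h4
  simp only [cesaro, Pi.neg_apply, integral_neg, Finset.sum_neg_distrib, smul_neg] at h3 h4
  rw [Real.dist_eq, abs_lt]
  constructor <;> simp only [cesaro] <;> linarith

end Birkhoff

section VanDerCorput

lemma norm_cesaro_le {E : Type*} [NormedAddCommGroup E] [NormedSpace ℝ E] {u : ℕ → E} {C : ℝ}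
    (hu : ∀ k, ‖u k‖ ≤ C) (N : ℕ) : ‖cesaro u N‖ ≤ C := by
  have hC : 0 ≤ C := (norm_nonneg _).trans (hu 0)
  rw [cesaro, norm_smul, norm_inv, Real.norm_natCast]
  rcases N.eq_zero_or_pos with rfl | hN
  · simpa
  · rw [inv_mul_le_iff₀ (by exact_mod_cast hN)]
    exact (norm_sum_le_of_le _ fun k _ => hu k).trans (by simp)

lemma tendsto_cesaro_shift_sub {E : Type*} [NormedAddCommGroup E] [NormedSpace ℝ E] {u : ℕ → E}
    {C : ℝ} (hu : ∀ k, ‖u k‖ ≤ C) (h : ℕ) :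
    Tendsto (fun N => cesaro (fun k => u (k + h)) N - cesaro u N) atTop (𝓝 0) := by
  have hlim : Tendsto (fun N : ℕ => (N : ℝ)⁻¹ * (2 * h * C)) atTop (𝓝 (0 * (2 * h * C))) :=
    tendsto_natCast_atTop_atTop.inv_tendsto_atTop.mul_const _
  rw [zero_mul] at hlim
  refine squeeze_zero_norm (fun N => ?_) hlim
  have hsum : ∑ k ∈ Finset.range N, u (k + h) - ∑ k ∈ Finset.range N, u k =
      ∑ k ∈ Finset.range h, u (N + k) - ∑ k ∈ Finset.range h, u k := by
    have h1 := Finset.sum_range_add u N h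
    have h2 := Finset.sum_range_add u h N
    rw [add_comm h N, h1] at h2
    simp_rw [add_comm _ h]
    rw [sub_eq_sub_iff_add_eq_add, add_comm, ← h2, add_comm]
  rw [cesaro, cesaro, ← smul_sub, norm_smul, norm_inv, Real.norm_natCast, hsum]
  gcongr
  refine (norm_sub_le _ _).trans ?_
  have h1 := norm_sum_le_of_le (Finset.range h) fun k _ => hu (N + k)
  have h2 := norm_sum_le_of_le (Finset.range h) fun k _ => hu k
  simp only [Finset.sum_const, Finset.card_range, nsmul_eq_mul] at h1 h2
  linarith

lemma norm_sq_cesaro_le {E : Type*} [NormedAddCommGroup E] [NormedSpace ℝ E] (u : ℕ → E) (N : ℕ) :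
    ‖cesaro u N‖ ^ 2 ≤ cesaro (fun k => ‖u k‖ ^ 2) N := by
  rcases N.eq_zero_or_pos with rfl | hN
  · simp [cesaro]
  have hN' : (0 : ℝ) < N := by exact_mod_cast hN
  have h1 : ‖∑ k ∈ Finset.range N, u k‖ ^ 2 ≤ N * ∑ k ∈ Finset.range N, ‖u k‖ ^ 2 := by
    calc _ ≤ (∑ k ∈ Finset.range N, ‖u k‖) ^ 2 := by gcongr; exact norm_sum_le _ _
      _ ≤ _ := by simpa using sq_sum_le_card_mul_sum_sq (s := Finset.range N) (f := fun k => ‖u k‖)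
  rw [cesaro, norm_smul, norm_inv, Real.norm_natCast, cesaro, smul_eq_mul, mul_pow]
  calc ((N : ℝ)⁻¹) ^ 2 * ‖∑ k ∈ Finset.range N, u k‖ ^ 2
      ≤ ((N : ℝ)⁻¹) ^ 2 * (N * ∑ k ∈ Finset.range N, ‖u k‖ ^ 2) := by gcongr
    _ = _ := by field_simp

/-- A qualitative form of van der Corput's inequality. -/
theorem tendsto_cesaro_zero_of_correlations {u : ℕ → ℂ} {C : ℝ} (hu : ∀ k, ‖u k‖ ≤ C)
    {c : ℕ → ℕ → ℝ}
    (hc : ∀ i j, Tendsto (fun N => ‖cesaro (fun k => u (k + i) * star (u (k + j))) N‖) atTop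
      (𝓝 (c i j)))
    (hlim : Tendsto (fun H => cesaro (fun i => cesaro (fun j => c i j) H) H) atTop (𝓝 0)) :
    Tendsto (cesaro u) atTop (𝓝 0) := by
  rw [Metric.tendsto_nhds]
  intro ε hε
  obtain ⟨H, hH, hHpos⟩ := ((hlim.eventually_lt_const (show 0 < (ε / 2) ^ 2 by positivity)).and
    (eventually_gt_atTop 0)).exists
  have hHne : (H : ℝ) ≠ 0 := by exact_mod_cast hHpos.ne'
  set v : ℕ → ℂ := fun k => cesaro (fun h => u (k + h)) H with hv
  have hdiff : Tendsto (fun N => cesaro v N - cesaro u N) atTop (𝓝 0) := by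
    have h1 : Tendsto (fun N => cesaro (fun h => cesaro (fun k => u (k + h)) N - cesaro u N) H)
        atTop (𝓝 ((H : ℝ)⁻¹ • ∑ h ∈ Finset.range H, (0 : ℂ))) :=
      (tendsto_finsetSum _ fun h _ => tendsto_cesaro_shift_sub hu h).const_smul _
    simp only [Finset.sum_const_zero, smul_zero] at h1
    refine h1.congr fun N => ?_
    simp only [hv, cesaro, Finset.sum_sub_distrib, smul_sub, Finset.sum_const, Finset.card_range,
      ← Finset.smul_sum]
    rw [← Nat.cast_smul_eq_nsmul ℝ, inv_smul_smul₀ hHne, smul_comm (N : ℝ)⁻¹, Finset.sum_comm]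
  have hcorr : Tendsto (fun N => cesaro (fun i => cesaro (fun j =>
      ‖cesaro (fun k => u (k + i) * star (u (k + j))) N‖) H) H) atTop
      (𝓝 (cesaro (fun i => cesaro (fun j => c i j) H) H)) :=
    (tendsto_finsetSum _ fun i _ => (tendsto_finsetSum _ fun j _ => hc i j).const_smul _).const_smul _
  have hbound : ∀ N, ‖cesaro v N‖ ^ 2 ≤ cesaro (fun i => cesaro (fun j =>
      ‖cesaro (fun k => u (k + i) * star (u (k + j))) N‖) H) H := by
    intro N
    refine (norm_sq_cesaro_le v N).trans ?_
    have hsq : ((cesaro (fun k => ‖v k‖ ^ 2) N : ℝ) : ℂ) = cesaro (fun i => cesaro (fun j =>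
        cesaro (fun k => u (k + i) * star (u (k + j))) N) H) H := by
      have hk : ∀ k, ((‖v k‖ ^ 2 : ℝ) : ℂ) = (H : ℝ)⁻¹ • (H : ℝ)⁻¹ •
          ∑ i ∈ Finset.range H, ∑ j ∈ Finset.range H, u (k + i) * star (u (k + j)) := by
        intro k
        rw [← Finset.sum_mul_sum]
        push_cast
        rw [← Complex.mul_conj']
        simp only [hv, cesaro, Complex.real_smul, map_mul, map_sum, Complex.conj_ofReal,
          Complex.star_def]
        ring
      simp only [cesaro, smul_eq_mul]
      push_cast
      simp only [← Complex.ofReal_pow, hk, ← Finset.smul_sum]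
      rw [Finset.sum_comm]
      simp_rw [Finset.sum_comm (s := Finset.range N)]
      simp only [Complex.real_smul]
      push_cast
      ring
    have hnonneg : 0 ≤ cesaro (fun k => ‖v k‖ ^ 2) N := by
      rw [cesaro, smul_eq_mul]
      positivity
    rw [← abs_of_nonneg hnonneg, ← Real.norm_eq_abs, ← Complex.norm_real, hsq]
    have htri : ∀ w : ℕ → ℂ, ‖cesaro w H‖ ≤ cesaro (fun i => ‖w i‖) H := fun w => by
      rw [cesaro, norm_smul, norm_inv, Real.norm_natCast, cesaro, smul_eq_mul]
      gcongr
      exact norm_sum_le _ _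
    refine (htri _).trans ?_
    simp only [cesaro, smul_eq_mul]
    gcongr with i
    exact htri _
  filter_upwards [hcorr.eventually_lt_const hH, (Metric.tendsto_nhds.1 hdiff) (ε / 2) (by positivity)]
    with N h1 h2
  have h3 : ‖cesaro v N‖ < ε / 2 := lt_of_pow_lt_pow_left₀ 2 (by positivity) ((hbound N).trans_lt h1)
  rw [dist_zero_right] at h2 ⊢
  calc ‖cesaro u N‖ = ‖cesaro v N - (cesaro v N - cesaro u N)‖ := by rw [sub_sub_cancel]
    _ ≤ ‖cesaro v N‖ + ‖cesaro v N - cesaro u N‖ := norm_sub_le _ _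
    _ < ε := by linarith

end VanDerCorput

section WeakMixing

variable {Ω : Type*} [MeasurableSpace Ω] {T : Ω → Ω} {μ : Measure Ω} [IsProbabilityMeasure μ]
  {F : Ω → ℝ}

lemma integrable_of_abs_le {f : Ω → ℝ} {C : ℝ} (hf : Measurable f) (hC : ∀ ω, |f ω| ≤ C) :
    Integrable f μ :=
  .of_bound hf.aestronglyMeasurable C (ae_of_all _ hC)

lemma WeakMixing.ergodic (hwm : WeakMixing T μ) (hT : Measurable T) : Ergodic T μ :=
  measurePreserving_fst.ergodic_of_ergodic_semiconj hwm hT fun _ => rfl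

lemma WeakMixing.tendsto_integral_sq_cesaro (hwm : WeakMixing T μ) (hT : Measurable T)
    (hF : Measurable F) {C : ℝ} (hC : ∀ ω, |F ω| ≤ C) (h0 : ∫ ω, F ω ∂μ = 0) :
    Tendsto (fun H => ∫ p, cesaro (fun k => F (T^[k] p.1) * F (T^[k] p.2)) H ^ 2 ∂μ.prod μ)
      atTop (𝓝 0) := by
  have hG : Measurable fun p : Ω × Ω => F p.1 * F p.2 :=
    (hF.comp measurable_fst).mul (hF.comp measurable_snd)
  have hGC : ∀ x y, |F x * F y| ≤ C * C := fun x y => by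
    rw [abs_mul]
    exact mul_le_mul (hC _) (hC _) (abs_nonneg _) ((abs_nonneg _).trans (hC x))
  have hTk : ∀ k, Measurable T^[k] := fun k => hT.iterate k
  have hb := Ergodic.ae_tendsto_cesaro (T := Prod.map T T) (μ := μ.prod μ) hwm hG
    (integrable_of_abs_le hG fun p => hGC _ _)
  simp only [Prod.map_iterate, Prod.map_fst, Prod.map_snd, integral_prod_mul, h0, mul_zero] at hb
  have := tendsto_integral_of_dominated_convergence (μ := μ.prod μ)
    (F := fun H p => cesaro (fun k => F (T^[k] p.1) * F (T^[k] p.2)) H ^ 2)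
    (f := fun _ => 0) (fun _ => (C * C) ^ 2) (fun H => ?_) (integrable_const _) (fun H => ?_) ?_
  · simpa using this
  · have hsum : Measurable fun p : Ω × Ω =>
        ∑ k ∈ Finset.range H, F (T^[k] p.1) * F (T^[k] p.2) :=
      Finset.measurable_fun_sum _ fun k _ => (hF.comp ((hTk k).comp measurable_fst)).mul
        (hF.comp ((hTk k).comp measurable_snd))
    exact ((hsum.const_smul (H : ℝ)⁻¹).pow_const 2).aestronglyMeasurable
  · refine ae_of_all _ fun p => ?_
    rw [norm_pow]
    gcongr
    exact norm_cesaro_le (fun k => hGC _ _) H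
  · filter_upwards [hb] with p hp
    simpa using hp.pow 2

lemma integral_sq_cesaro_prod (hT : Measurable T) (hF : Measurable F) {C : ℝ}
    (hC : ∀ ω, |F ω| ≤ C) (H : ℕ) :
    ∫ p, cesaro (fun k => F (T^[k] p.1) * F (T^[k] p.2)) H ^ 2 ∂μ.prod μ =
      cesaro (fun i => cesaro (fun j => (∫ ω, F (T^[i] ω) * F (T^[j] ω) ∂μ) ^ 2) H) H := by
  have hFk : ∀ k, Measurable fun ω => F (T^[k] ω) := fun k => hF.comp (hT.iterate k)
  have hint : ∀ i j, Integrable (fun ω => F (T^[i] ω) * F (T^[j] ω)) μ := fun i j =>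
    integrable_of_abs_le (C := C * C) ((hFk i).mul (hFk j)) fun ω => by
      rw [abs_mul]
      exact mul_le_mul (hC _) (hC _) (abs_nonneg _) ((abs_nonneg _).trans (hC ω))
  have hexp : ∀ p : Ω × Ω, cesaro (fun k => F (T^[k] p.1) * F (T^[k] p.2)) H ^ 2 =
      (H : ℝ)⁻¹ * ((H : ℝ)⁻¹ * ∑ i ∈ Finset.range H, ∑ j ∈ Finset.range H,
        (F (T^[i] p.1) * F (T^[j] p.1)) * (F (T^[i] p.2) * F (T^[j] p.2))) := by
    intro p
    rw [cesaro, smul_eq_mul, mul_pow, sq (∑ _ ∈ _, _), Finset.sum_mul_sum, sq, mul_assoc]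
    refine congrArg _ (congrArg _ (Finset.sum_congr rfl fun i _ => Finset.sum_congr rfl fun j _ => ?_))
    ring
  have hprod : ∀ i j, Integrable (fun p : Ω × Ω =>
      (F (T^[i] p.1) * F (T^[j] p.1)) * (F (T^[i] p.2) * F (T^[j] p.2))) (μ.prod μ) :=
    fun i j => (hint i j).mul_prod (hint i j)
  simp_rw [hexp]
  rw [integral_const_mul, integral_const_mul,
    integral_finsetSum _ fun i _ => integrable_finsetSum _ fun j _ => hprod i j]
  simp only [cesaro, smul_eq_mul, ← Finset.mul_sum]
  congr! 3 with i
  rw [integral_finsetSum _ fun j _ => hprod i j]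
  refine Finset.sum_congr rfl fun j _ => ?_
  rw [integral_prod_mul (fun ω => F (T^[i] ω) * F (T^[j] ω)) fun ω => F (T^[i] ω) * F (T^[j] ω), sq]

lemma WeakMixing.tendsto_cesaro_correlations (hwm : WeakMixing T μ) (hT : Measurable T)
    (hF : Measurable F) {C : ℝ} (hC : ∀ ω, |F ω| ≤ C) (h0 : ∫ ω, F ω ∂μ = 0) :
    Tendsto (fun H => cesaro (fun i => cesaro (fun j =>
      |∫ ω, F (T^[i] ω) * F (T^[j] ω) ∂μ|) H) H) atTop (𝓝 0) := by
  have hlim := (hwm.tendsto_integral_sq_cesaro hT hF hC h0).sqrt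
  rw [Real.sqrt_zero] at hlim
  refine squeeze_zero_norm (fun H => Real.abs_le_sqrt ?_) hlim
  rw [integral_sq_cesaro_prod hT hF hC, ← sq_abs, ← Real.norm_eq_abs]
  refine (norm_sq_cesaro_le _ H).trans ?_
  simp only [cesaro, smul_eq_mul]
  gcongr with i
  refine (norm_sq_cesaro_le (fun j => |∫ ω, F (T^[i] ω) * F (T^[j] ω) ∂μ|) H).trans_eq ?_
  simp [cesaro]

/-- A Wiener-Wintner theorem: for a weak mixing transformation, almost every orbit of a bounded
mean-zero function is asymptotically orthogonal to all unimodular characters of `ℕ`. -/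
theorem WeakMixing.ae_tendsto_cesaro_pow_mul (hwm : WeakMixing T μ) (hT : Measurable T)
    (hF : Measurable F) {C : ℝ} (hC : ∀ ω, |F ω| ≤ C) (h0 : ∫ ω, F ω ∂μ = 0) :
    ∀ᵐ ω ∂μ, ∀ z : ℂ, ‖z‖ = 1 →
      Tendsto (cesaro fun k => z ^ k * (F (T^[k] ω) : ℂ)) atTop (𝓝 0) := by
  have hFk : ∀ k, Measurable fun ω => F (T^[k] ω) := fun k => hF.comp (hT.iterate k)
  have hb : ∀ᵐ ω ∂μ, ∀ i j, Tendsto (cesaro fun k => F (T^[i] (T^[k] ω)) * F (T^[j] (T^[k] ω)))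
      atTop (𝓝 (∫ ω, F (T^[i] ω) * F (T^[j] ω) ∂μ)) := by
    refine ae_all_iff.2 fun i => ae_all_iff.2 fun j => ?_
    refine (hwm.ergodic hT).ae_tendsto_cesaro ((hFk i).mul (hFk j))
      (integrable_of_abs_le (C := C * C) ((hFk i).mul (hFk j)) fun ω => ?_)
    rw [abs_mul]
    exact mul_le_mul (hC _) (hC _) (abs_nonneg _) ((abs_nonneg _).trans (hC ω))
  filter_upwards [hb] with ω hω z hz
  refine tendsto_cesaro_zero_of_correlations (C := C) (fun k => ?_) (fun i j => ?_)
    (hwm.tendsto_cesaro_correlations hT hF hC h0)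
  · simpa [hz] using hC _
  · refine (hω i j).abs.congr fun N => ?_
    have hterm : ∀ k, z ^ (k + i) * (F (T^[k + i] ω) : ℂ) *
        star (z ^ (k + j) * (F (T^[k + j] ω) : ℂ)) = (z ^ i * star z ^ j) *
          ((F (T^[i] (T^[k] ω)) * F (T^[j] (T^[k] ω)) : ℝ) : ℂ) := by
      intro k
      have hzz : z ^ k * star z ^ k = 1 := by
        rw [← mul_pow, Complex.star_def, Complex.mul_conj', hz]
        simp
      rw [← Function.iterate_add_apply, ← Function.iterate_add_apply, add_comm i k, add_comm j k]
      push_cast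
      simp only [star_mul', star_pow, Complex.star_def, Complex.conj_ofReal, pow_add] at hzz ⊢
      linear_combination (z ^ i * (starRingEnd ℂ) z ^ j * (F (T^[k + i] ω) : ℂ) *
        (F (T^[k + j] ω) : ℂ)) * hzz
    simp only [hterm, cesaro, ← Finset.mul_sum, ← Complex.ofReal_sum, smul_eq_mul, abs_mul,
      norm_smul, norm_mul, norm_pow, norm_star, hz, one_pow, one_mul, Complex.norm_real,
      Real.norm_eq_abs]

end WeakMixing

section UpperEnvelope

variable {X : Type*} [PseudoMetricSpace X]

/-- The least `n`-Lipschitz majorant of `g`. -/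
noncomputable def lipschitzMajorant (g : X → ℝ) (n : ℕ) (x : X) : ℝ :=
  ⨆ y, (g y - n * dist x y)

variable {g : X → ℝ} {C : ℝ}

lemma bddAbove_range_sub_mul_dist (hg : ∀ x, |g x| ≤ C) (n : ℕ) (x : X) :
    BddAbove (Set.range fun y => g y - n * dist x y) := by
  refine ⟨C, ?_⟩
  rintro _ ⟨y, rfl⟩
  have := (abs_le.1 (hg y)).2
  have : 0 ≤ n * dist x y := by positivity
  simp only
  linarith

lemma le_lipschitzMajorant (hg : ∀ x, |g x| ≤ C) (n : ℕ) (x : X) :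
    g x ≤ lipschitzMajorant g n x := by
  simpa [lipschitzMajorant] using le_ciSup (bddAbove_range_sub_mul_dist hg n x) x

lemma abs_lipschitzMajorant_le (hg : ∀ x, |g x| ≤ C) (n : ℕ) (x : X) :
    |lipschitzMajorant g n x| ≤ C := by
  have : Nonempty X := ⟨x⟩
  refine abs_le.2 ⟨(abs_le.1 (hg x)).1.trans (le_lipschitzMajorant hg n x), ciSup_le fun y => ?_⟩
  have := (abs_le.1 (hg y)).2
  have : 0 ≤ n * dist x y := by positivity
  linarith

lemma continuous_lipschitzMajorant (hg : ∀ x, |g x| ≤ C) (n : ℕ) :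
    Continuous (lipschitzMajorant g n) := by
  refine (LipschitzWith.of_le_add_mul (n : NNReal) fun x y => ?_).continuous
  have : Nonempty X := ⟨x⟩
  refine ciSup_le fun z => ?_
  have h1 : g z - n * dist y z ≤ lipschitzMajorant g n y :=
    le_ciSup (bddAbove_range_sub_mul_dist hg n y) z
  have h2 : (n : ℝ) * dist y z ≤ n * (dist x y + dist x z) := by
    gcongr
    exact dist_triangle_left y z x
  simp only [NNReal.coe_natCast]
  linarith

lemma tendsto_lipschitzMajorant (hg : ∀ x, |g x| ≤ C) {x : X} (hx : ContinuousAt g x) :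
    Tendsto (fun n => lipschitzMajorant g n x) atTop (𝓝 (g x)) := by
  have : Nonempty X := ⟨x⟩
  rw [Metric.tendsto_nhds]
  intro ε hε
  obtain ⟨δ, hδ, hclose⟩ := Metric.continuousAt_iff.1 hx (ε / 2) (by positivity)
  filter_upwards [tendsto_natCast_atTop_atTop.eventually_ge_atTop (2 * C / δ)] with n hn
  have hle : lipschitzMajorant g n x ≤ g x + ε / 2 := by
    refine ciSup_le fun y => ?_
    have h0 : 0 ≤ n * dist x y := by positivity
    rcases lt_or_ge (dist y x) δ with hy | hy
    · have := (abs_lt.1 (hclose hy)).2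
      linarith
    · rw [dist_comm] at hy
      have h1 : (n : ℝ) * δ ≤ n * dist x y := by gcongr
      have h2 := (div_le_iff₀ hδ).1 hn
      have := (abs_le.1 (hg y)).2
      have := (abs_le.1 (hg x)).1
      linarith
  rw [Real.dist_eq, abs_of_nonneg (sub_nonneg.2 (le_lipschitzMajorant hg n x))]
  linarith

lemma tendsto_integral_lipschitzMajorant [MeasurableSpace X] [OpensMeasurableSpace X]
    (ν : Measure X) [IsFiniteMeasure ν] (hg : ∀ x, |g x| ≤ C) (hcont : ∀ᵐ x ∂ν, ContinuousAt g x) :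
    Tendsto (fun n => ∫ x, lipschitzMajorant g n x ∂ν) atTop (𝓝 (∫ x, g x ∂ν)) :=
  tendsto_integral_of_dominated_convergence (fun _ => C)
    (fun n => (continuous_lipschitzMajorant hg n).measurable.aestronglyMeasurable)
    (integrable_const _) (fun n => ae_of_all _ (abs_lipschitzMajorant_le hg n))
    (hcont.mono fun _ hx => tendsto_lipschitzMajorant hg hx)

end UpperEnvelope

lemma tendsto_cesaro_pow {z : ℂ} (hz : ‖z‖ = 1) (hz1 : z ≠ 1) :
    Tendsto (cesaro fun k => z ^ k) atTop (𝓝 0) := by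
  have hlim : Tendsto (fun N : ℕ => (N : ℝ)⁻¹ * (2 / ‖z - 1‖)) atTop (𝓝 (0 * (2 / ‖z - 1‖))) :=
    tendsto_natCast_atTop_atTop.inv_tendsto_atTop.mul_const _
  rw [zero_mul] at hlim
  refine squeeze_zero_norm (fun N => ?_) hlim
  rw [cesaro, norm_smul, norm_inv, Real.norm_natCast, geom_sum_eq hz1, norm_div]
  gcongr
  refine (norm_sub_le _ _).trans ?_
  simp [hz]
  norm_num

/-- The weight `W` has mean `L` and is asymptotically orthogonal to every nontrivial unimodular
character of `ℕ`. -/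
structure HasOnlyTrivialFrequency (W : ℕ → ℝ) (L : ℝ) : Prop where
  bounded : ∃ C, ∀ k, |W k| ≤ C
  tendsto_mean : Tendsto (cesaro fun k => (W k : ℂ)) atTop (𝓝 (L : ℂ))
  tendsto_char : ∀ z : ℂ, ‖z‖ = 1 → z ≠ 1 → Tendsto (cesaro fun k => z ^ k * (W k : ℂ)) atTop (𝓝 0)

namespace HasOnlyTrivialFrequency

lemma const (c : ℝ) : HasOnlyTrivialFrequency (fun _ => c) c where
  bounded := ⟨|c|, fun _ => le_rfl⟩
  tendsto_mean := by
    refine tendsto_const_nhds.congr' ?_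
    filter_upwards [eventually_gt_atTop 0] with N hN
    have : (N : ℂ) ≠ 0 := by exact_mod_cast hN.ne'
    simp [cesaro, this]
  tendsto_char z hz hz1 := by
    have := (tendsto_cesaro_pow hz hz1).mul_const (c : ℂ)
    rw [zero_mul] at this
    refine this.congr fun N => ?_
    simp only [cesaro, ← Finset.sum_mul, smul_mul_assoc]

lemma add {W V : ℕ → ℝ} {L M : ℝ} (hW : HasOnlyTrivialFrequency W L)
    (hV : HasOnlyTrivialFrequency V M) : HasOnlyTrivialFrequency (fun k => W k + V k) (L + M) where
  bounded := by
    obtain ⟨C, hC⟩ := hW.bounded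
    obtain ⟨D, hD⟩ := hV.bounded
    exact ⟨C + D, fun k => (abs_add_le _ _).trans (add_le_add (hC k) (hD k))⟩
  tendsto_mean := by
    have := hW.tendsto_mean.add hV.tendsto_mean
    rw [← Complex.ofReal_add] at this
    refine this.congr fun N => ?_
    simp only [cesaro, Complex.ofReal_add, Finset.sum_add_distrib, smul_add]
  tendsto_char z hz hz1 := by
    have := (hW.tendsto_char z hz hz1).add (hV.tendsto_char z hz hz1)
    rw [zero_add] at this
    refine this.congr fun N => ?_
    simp only [cesaro, Complex.ofReal_add, mul_add, Finset.sum_add_distrib, smul_add]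

variable {W : ℕ → ℝ} {L : ℝ} {b : UnitAddCircle}

lemma tendsto_cesaro_fourier (hW : HasOnlyTrivialFrequency W L)
    (hb : ∀ m : ℤ, m ≠ 0 → fourier m b ≠ 1) (x : UnitAddCircle) (m : ℤ) :
    Tendsto (cesaro fun k => fourier m (x + k • b) * (W k : ℂ)) atTop
      (𝓝 ((∫ y : UnitAddCircle, fourier m y) * L)) := by
  have hadd : ∀ y y' : UnitAddCircle, fourier m (y + y') = fourier m y * fourier m y' := by
    intro y y'
    simp [smul_add, AddCircle.toCircle_add]
  have hpow : ∀ k : ℕ, fourier m (k • b) = fourier m b ^ k := by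
    intro k
    induction k with
    | zero => simp
    | succ k ih => rw [succ_nsmul, hadd, ih, pow_succ]
  rcases eq_or_ne m 0 with rfl | hm
  · simpa [measureReal_def] using hW.tendsto_mean
  · have hint : ∫ y : UnitAddCircle, fourier m y = 0 := by
      have h1 := integral_add_right_eq_self (μ := (volume : Measure UnitAddCircle))
        (fun y => fourier m y) b
      simp_rw [hadd] at h1
      rw [integral_mul_const] at h1
      refine (mul_eq_zero.1 (show (∫ y : UnitAddCircle, fourier m y) * (fourier m b - 1) = 0 by
        rw [mul_sub, h1, mul_one, sub_self])).resolve_right (sub_ne_zero.2 (hb m hm))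
    have := (hW.tendsto_char (fourier m b) (Circle.norm_coe _) (hb m hm)).const_mul (fourier m x)
    rw [mul_zero] at this
    rw [hint, zero_mul]
    refine this.congr fun N => ?_
    simp only [hadd, hpow, cesaro, mul_assoc, ← Finset.mul_sum, mul_smul_comm]

lemma tendsto_cesaro_complex (hW : HasOnlyTrivialFrequency W L)
    (hb : ∀ m : ℤ, m ≠ 0 → fourier m b ≠ 1) (x : UnitAddCircle) (f : C(UnitAddCircle, ℂ)) :
    Tendsto (cesaro fun k => f (x + k • b) * (W k : ℂ)) atTop
      (𝓝 ((∫ y, f y) * L)) := by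
  obtain ⟨C, hC⟩ := hW.bounded
  have hC0 : 0 ≤ C := (abs_nonneg _).trans (hC 0)
  have hint : ∀ f : C(UnitAddCircle, ℂ), Integrable f := fun f =>
    .of_bound f.continuous.aestronglyMeasurable ‖f‖ (ae_of_all _ f.norm_coe_le_norm)
  have hspan : ∀ p ∈ Submodule.span ℂ (Set.range (fourier (T := 1))),
      Tendsto (cesaro fun k => p (x + k • b) * (W k : ℂ)) atTop (𝓝 ((∫ y, p y) * L)) := by
    intro p hp
    induction hp using Submodule.span_induction with
    | mem p hp =>
      obtain ⟨m, rfl⟩ := hp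
      exact hW.tendsto_cesaro_fourier hb x m
    | zero =>
      simp only [ContinuousMap.zero_apply, zero_mul, integral_zero]
      exact tendsto_const_nhds.congr fun N => by simp [cesaro]
    | add p q _ _ hp hq =>
      have := hp.add hq
      rw [← add_mul, ← integral_add (hint p) (hint q)] at this
      refine this.congr fun N => ?_
      simp only [cesaro, ContinuousMap.add_apply, add_mul, Finset.sum_add_distrib, smul_add]
    | smul a p _ hp =>
      have := hp.const_mul a
      rw [← mul_assoc, ← integral_const_mul] at this
      refine this.congr fun N => ?_
      simp only [cesaro, ContinuousMap.smul_apply, smul_eq_mul, mul_assoc, ← Finset.mul_sum,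
        mul_smul_comm]
  rw [Metric.tendsto_nhds]
  intro ε hε
  obtain ⟨δ, hδ, hδε⟩ : ∃ δ > 0, δ * (C + |L|) < ε / 2 := by
    refine ⟨ε / 2 / (C + |L| + 1), by positivity, ?_⟩
    rw [div_mul_eq_mul_div, div_lt_iff₀ (by positivity)]
    exact mul_lt_mul_of_pos_left (lt_add_one _) (by positivity)
  have hf : f ∈ closure
      (Submodule.span ℂ (Set.range (fourier (T := 1))) : Set C(UnitAddCircle, ℂ)) := by
    rw [← Submodule.topologicalClosure_coe, span_fourier_closure_eq_top]
    trivial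
  obtain ⟨p, hp, hfp⟩ := Metric.mem_closure_iff.1 hf δ hδ
  rw [dist_eq_norm] at hfp
  have hpt : ∀ y, ‖f y - p y‖ ≤ δ := fun y => ((f - p).norm_coe_le_norm y).trans hfp.le
  have hI : ‖(∫ y, f y) * L - (∫ y, p y) * (L : ℂ)‖ ≤ δ * |L| := by
    rw [← sub_mul, ← integral_sub (hint f) (hint p), norm_mul, Complex.norm_real, Real.norm_eq_abs]
    gcongr
    simpa [measureReal_def] using norm_integral_le_of_norm_le_const (μ := (volume : Measure UnitAddCircle))
      (ae_of_all _ hpt)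
  filter_upwards [Metric.tendsto_nhds.1 (hspan p hp) (ε / 2) (by positivity)] with N hN
  have hA : ‖cesaro (fun k => f (x + k • b) * (W k : ℂ)) N -
      cesaro (fun k => p (x + k • b) * (W k : ℂ)) N‖ ≤ δ * C := by
    have := norm_cesaro_le (u := fun k => (f (x + k • b) - p (x + k • b)) * (W k : ℂ))
      (C := δ * C) (fun k => ?_) N
    · simpa only [cesaro, sub_mul, Finset.sum_sub_distrib, smul_sub] using this
    · rw [norm_mul, Complex.norm_real]
      exact mul_le_mul (hpt _) (hC k) (norm_nonneg _) hδ.le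
  rw [dist_eq_norm] at hN ⊢
  have htri := norm_add₃_le (a := cesaro (fun k => f (x + k • b) * (W k : ℂ)) N -
      cesaro (fun k => p (x + k • b) * (W k : ℂ)) N)
    (b := cesaro (fun k => p (x + k • b) * (W k : ℂ)) N - (∫ y, p y) * L)
    (c := (∫ y, p y) * L - (∫ y, f y) * (L : ℂ))
  rw [sub_add_sub_cancel, sub_add_sub_cancel] at htri
  rw [norm_sub_rev] at hI
  linarith

lemma tendsto_cesaro_continuous (hW : HasOnlyTrivialFrequency W L)
    (hb : ∀ m : ℤ, m ≠ 0 → fourier m b ≠ 1) (x : UnitAddCircle) {f : UnitAddCircle → ℝ}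
    (hf : Continuous f) :
    Tendsto (cesaro fun k => f (x + k • b) * W k) atTop (𝓝 ((∫ y, f y) * L)) := by
  have := hW.tendsto_cesaro_complex hb x ⟨fun y => (f y : ℂ), Complex.continuous_ofReal.comp hf⟩
  simp only [ContinuousMap.coe_mk, integral_complex_ofReal, ← Complex.ofReal_mul] at this
  refine ((Complex.continuous_re.tendsto _).comp this).congr fun N => ?_
  simp only [Function.comp_apply, cesaro, ← Complex.ofReal_sum, Complex.smul_re, Complex.ofReal_re]

variable {g : UnitAddCircle → ℝ} {C : ℝ}

lemma eventually_cesaro_lt (hW : HasOnlyTrivialFrequency W L) (hW0 : ∀ k, 0 ≤ W k)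
    (hb : ∀ m : ℤ, m ≠ 0 → fourier m b ≠ 1) (x : UnitAddCircle) (hg : ∀ y, |g y| ≤ C)
    (hcont : ∀ᵐ y, ContinuousAt g y) {a : ℝ} (ha : (∫ y, g y) * L < a) :
    ∀ᶠ N in atTop, cesaro (fun k => g (x + k • b) * W k) N < a := by
  obtain ⟨n, hn⟩ := (((tendsto_integral_lipschitzMajorant volume hg hcont).mul_const
    L).eventually_lt_const ha).exists
  filter_upwards [(hW.tendsto_cesaro_continuous hb x
    (continuous_lipschitzMajorant hg n)).eventually_lt_const hn] with N hN
  refine lt_of_le_of_lt ?_ hN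
  simp only [cesaro, smul_eq_mul]
  gcongr with k
  · exact hW0 k
  · exact le_lipschitzMajorant hg n _

lemma tendsto_cesaro_of_nonneg (hW : HasOnlyTrivialFrequency W L) (hW0 : ∀ k, 0 ≤ W k)
    (hb : ∀ m : ℤ, m ≠ 0 → fourier m b ≠ 1) (x : UnitAddCircle) (hg : ∀ y, |g y| ≤ C)
    (hcont : ∀ᵐ y, ContinuousAt g y) :
    Tendsto (cesaro fun k => g (x + k • b) * W k) atTop (𝓝 ((∫ y, g y) * L)) := by
  refine tendsto_order.2 ⟨fun a ha => ?_, fun a ha => hW.eventually_cesaro_lt hW0 hb x hg hcont ha⟩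
  have := hW.eventually_cesaro_lt (g := fun y => -g y) (a := -a) hW0 hb x (by simpa using hg)
    (hcont.mono fun y hy => hy.neg) (by rw [integral_neg]; linarith)
  filter_upwards [this] with N hN
  simp only [cesaro, neg_mul, Finset.sum_neg_distrib, smul_neg, neg_lt_neg_iff] at hN
  exact hN

/-- Weighted equidistribution of irrational rotations, for Riemann integrable observables. -/
theorem tendsto_cesaro (hW : HasOnlyTrivialFrequency W L)
    (hb : ∀ m : ℤ, m ≠ 0 → fourier m b ≠ 1) (x : UnitAddCircle) (hg : ∀ y, |g y| ≤ C)
    (hcont : ∀ᵐ y, ContinuousAt g y) :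
    Tendsto (cesaro fun k => g (x + k • b) * W k) atTop (𝓝 ((∫ y, g y) * L)) := by
  obtain ⟨D, hD⟩ := hW.bounded
  have hD0 : 0 ≤ D := (abs_nonneg _).trans (hD 0)
  have h1 := (hW.add (const D)).tendsto_cesaro_of_nonneg
    (fun k => by linarith [(abs_le.1 (hD k)).1]) hb x hg hcont
  have h2 := (const D).tendsto_cesaro_of_nonneg (fun _ => hD0) hb x hg hcont
  have := h1.sub h2
  rw [← mul_sub, add_sub_cancel_right] at this
  refine this.congr fun N => ?_
  simp only [cesaro, mul_add, Finset.sum_add_distrib, smul_add, add_sub_cancel_right]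

end HasOnlyTrivialFrequency

lemma fourier_coe_ne_one_of_irrational {β : ℝ} (hβ : Irrational β) {m : ℤ} (hm : m ≠ 0) :
    fourier m (β : UnitAddCircle) ≠ 1 := by
  intro h
  have h1 : (m • (β : UnitAddCircle)) = 0 := by
    apply AddCircle.injective_toCircle one_ne_zero
    rw [AddCircle.toCircle_zero]
    exact Circle.ext h
  rw [← AddCircle.coe_zsmul, AddCircle.coe_eq_zero_iff] at h1
  obtain ⟨n, hn⟩ := h1
  simp only [zsmul_eq_mul, mul_one] at hn
  exact (hβ.intCast_mul hm).ne_int n hn.symm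

lemma liftIco_coe_eq_fract (g : ℝ → ℝ) (y : ℝ) :
    AddCircle.liftIco 1 0 g (y : UnitAddCircle) = g (Int.fract y) := by
  have h : (y : UnitAddCircle) = (Int.fract y : ℝ) := by
    rw [Int.fract, AddCircle.coe_sub, eq_comm, sub_eq_self, AddCircle.coe_eq_zero_iff]
    exact ⟨⌊y⌋, by simp⟩
  rw [h, AddCircle.liftIco_zero_coe_apply ⟨Int.fract_nonneg y, Int.fract_lt_one y⟩]

lemma ae_continuousAt_liftIco {g : ℝ → ℝ} (hg : ∀ᵐ x ∂(volume.restrict (Set.Ico (0 : ℝ) 1)),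
    ContinuousWithinAt g (Set.Ico (0 : ℝ) 1) x) :
    ∀ᵐ y : UnitAddCircle, ContinuousAt (AddCircle.liftIco 1 0 g) y := by
  have hmk := UnitAddCircle.measurePreserving_mk 0
  rw [← hmk.map_eq, ae_map_iff hmk.aemeasurable (IsGδ.setOfPred_continuousAt _).measurableSet, zero_add,
    ← restrict_Ioo_eq_restrict_Ioc]
  rw [← restrict_Ioo_eq_restrict_Ico] at hg
  filter_upwards [hg, ae_restrict_mem measurableSet_Ioo] with x hx hx01
  have hq : IsOpenQuotientMap ((↑) : ℝ → UnitAddCircle) := QuotientAddGroup.isOpenQuotientMap_mk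
  rw [← hq.continuousAt_comp_iff]
  refine (hx.continuousAt (Ico_mem_nhds hx01.1 hx01.2)).congr ?_
  filter_upwards [Ico_mem_nhds hx01.1 hx01.2] with y hy
  exact (AddCircle.liftIco_zero_coe_apply hy).symm

lemma integral_liftIco (g : ℝ → ℝ) :
    ∫ y : UnitAddCircle, AddCircle.liftIco 1 0 g y = ∫ x in Set.Ico (0 : ℝ) 1, g x := by
  rw [← UnitAddCircle.integral_preimage 0, zero_add, ← integral_Ico_eq_integral_Ioc]
  exact setIntegral_congr_fun measurableSet_Ico fun x hx => AddCircle.liftIco_zero_coe_apply hx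

lemma WeakMixing.ae_hasOnlyTrivialFrequency {Ω : Type*} [MeasurableSpace Ω] {T : Ω → Ω}
    {μ : Measure Ω} [IsProbabilityMeasure μ] (hwm : WeakMixing T μ) (hT : Measurable T)
    {F : Ω → ℝ} (hF : Measurable F) {C : ℝ} (hC : ∀ ω, |F ω| ≤ C) :
    ∀ᵐ ω ∂μ, HasOnlyTrivialFrequency (fun k => F (T^[k] ω)) (∫ ω, F ω ∂μ) := by
  set L := ∫ ω, F ω ∂μ
  have h0 : ∫ ω, (F ω - L) ∂μ = 0 := by
    rw [integral_sub (integrable_of_abs_le hF hC) (integrable_const _)]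
    simp [L]
  have hbd : ∀ ω, |F ω - L| ≤ C + |L| := fun ω => (abs_sub _ _).trans (by gcongr; exact hC ω)
  filter_upwards [hwm.ae_tendsto_cesaro_pow_mul hT (hF.sub_const L) hbd h0] with ω hω
  have : HasOnlyTrivialFrequency (fun k => F (T^[k] ω) - L) 0 :=
    ⟨⟨_, fun k => hbd _⟩, by simpa using hω 1 (by simp), fun z hz _ => hω z hz⟩
  simpa using this.add (.const L)

theorem stmt15 {Ω : Type*} [MeasurableSpace Ω]
    (T : Ω → Ω) (μ : Measure Ω) [IsProbabilityMeasure μ]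
    (hT : MeasurePreserving T μ μ) (hwm : WeakMixing T μ)
    (β : ℝ) (hβ : Irrational β)
    (g : ℝ → ℝ) (hgbd : ∃ C : ℝ, ∀ x, |g x| ≤ C)
    (hgRiem : ∀ᵐ x ∂(volume.restrict (Set.Ico (0 : ℝ) 1)),
      ContinuousWithinAt g (Set.Ico (0 : ℝ) 1) x)
    (F : Ω → ℝ) (hFmeas : Measurable F) (hFbd : ∃ C : ℝ, ∀ ω, |F ω| ≤ C) :
    ∃ Ω' : Set Ω, μ Ω' = 1 ∧ ∀ ω ∈ Ω', ∀ t ∈ Set.Ico (0 : ℝ) 1,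
      Tendsto (fun N : ℕ => (N : ℝ)⁻¹ *
          ∑ k ∈ Finset.Icc 1 N, g (Int.fract (t + k * β)) * F (T^[k] ω))
        atTop (𝓝 ((∫ x in Set.Ico (0 : ℝ) 1, g x) * ∫ ω', F ω' ∂μ)) := by
  obtain ⟨A, hA⟩ := hgbd
  obtain ⟨B, hB⟩ := hFbd
  have hae := hT.quasiMeasurePreserving.ae (hwm.ae_hasOnlyTrivialFrequency hT.measurable hFmeas hB)
  refine ⟨{ω | HasOnlyTrivialFrequency (fun k => F (T^[k] (T ω))) (∫ ω, F ω ∂μ)},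
    (measure_congr (eventuallyEq_univ.2 hae)).trans measure_univ, fun ω hω t _ => ?_⟩
  have hlift : ∀ y : UnitAddCircle, |AddCircle.liftIco 1 0 g y| ≤ A := fun y => by
    obtain ⟨x, rfl⟩ := QuotientAddGroup.mk_surjective y
    exact (congrArg abs (liftIco_coe_eq_fract g x)).trans_le (hA _)
  have hlim := HasOnlyTrivialFrequency.tendsto_cesaro hω
    (fun m hm => fourier_coe_ne_one_of_irrational hβ hm) ((t + β : ℝ) : UnitAddCircle) hlift
    (ae_continuousAt_liftIco hgRiem)
  rw [integral_liftIco] at hlim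
  refine hlim.congr fun N => ?_
  have hterm : ∀ k : ℕ,
      AddCircle.liftIco 1 0 g (((t + β : ℝ) : UnitAddCircle) + k • (β : UnitAddCircle)) *
        F (T^[k] (T ω)) = g (Int.fract (t + (k + 1 : ℕ) * β)) * F (T^[k + 1] ω) := by
    intro k
    rw [← AddCircle.coe_nsmul, ← AddCircle.coe_add, liftIco_coe_eq_fract, nsmul_eq_mul,
      Function.iterate_succ_apply]
    push_cast
    ring_nf
  simp only [cesaro, smul_eq_mul, hterm]
  rw [Finset.range_eq_Ico,
    Finset.sum_Ico_add' (fun k : ℕ => g (Int.fract (t + k * β)) * F (T^[k] ω)) 0 N 1, zero_add,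
    Finset.Ico_add_one_right_eq_Icc]
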